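/- Let D ∈ ℝ^{p×m} and y ∈ ℝ^p. If ẑ ∈ B∞ minimizes the dual objective G(z) = ½‖Dz − y‖₂² over B∞, then the vector ŵ = y − Dẑ is the (unique) global minimizer over ℝ^p of the primal denoising objective F(w) = ½‖y − w‖₂² + ‖Dᵀw‖₁. -/

import Mathlib

/-- The closed unit ball of the ℓ∞ norm on ℝ^m. -/
def Binf (m : ℕ) : Set (Fin m → ℝ) := {z | ∀ i, |z i| ≤ 1}

/-- The primal denoising objective `F(w) = ½‖y − w‖₂² + ‖Dᵀw‖₁`. -/
noncomputable def primalObj {p m : ℕ} (D : Matrix (Fin p) (Fin m) ℝ)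
    (y w : Fin p → ℝ) : ℝ :=
  (1 / 2) * ∑ i, (y i - w i) ^ 2 + ∑ j, |D.transpose.mulVec w j|

/-- The dual objective `G(z) = ½‖Dz − y‖₂²`. -/
noncomputable def dualObj {p m : ℕ} (D : Matrix (Fin p) (Fin m) ℝ)
    (y : Fin p → ℝ) (z : Fin m → ℝ) : ℝ :=
  (1 / 2) * ∑ i, (D.mulVec z i - y i) ^ 2

theorem primalObj_eq_dotProduct {p m : ℕ} (D : Matrix (Fin p) (Fin m) ℝ) (y w : Fin p → ℝ) :
    primalObj D y w = (1 / 2) * ((y - w) ⬝ᵥ (y - w)) + ∑ j, |D.transpose.mulVec w j| := by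
  simp [primalObj, dotProduct, sq]

theorem dualObj_eq_dotProduct {p m : ℕ} (D : Matrix (Fin p) (Fin m) ℝ) (y : Fin p → ℝ)
    (z : Fin m → ℝ) :
    dualObj D y z = (1 / 2) * ((D.mulVec z - y) ⬝ᵥ (D.mulVec z - y)) := by
  simp [dualObj, dotProduct, sq]

theorem Binf_convex (m : ℕ) : Convex ℝ (Binf m) := by
  have h : Binf m = Set.Icc (fun _ => -1) (fun _ => 1) := by
    ext z
    simp [Binf, Set.mem_Icc, Pi.le_def, abs_le, forall_and]
  rw [h]
  exact convex_Icc _ _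

theorem nonneg_of_forall_quadratic_nonneg {b c : ℝ} (hc : 0 ≤ c)
    (h : ∀ t, 0 ≤ t → t ≤ 1 → 0 ≤ 2 * t * b + t ^ 2 * c) : 0 ≤ b := by
  by_contra! hb
  have hs : 0 < c - b + 1 := by linarith
  have ht : 0 < -b / (c - b + 1) := div_pos (by linarith) hs
  have h1 := h _ ht.le ((div_le_one hs).2 (by linarith))
  have h2 : -b / (c - b + 1) * (c - b + 1) = -b := div_mul_cancel₀ _ hs.ne'
  nlinarith [mul_pos ht ht]

/-- First-order optimality condition for the dual problem. -/
theorem dotProduct_mulVec_le_of_dual_minimizer {p m : ℕ} {D : Matrix (Fin p) (Fin m) ℝ}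
    {y : Fin p → ℝ} {zopt : Fin m → ℝ} (hz : zopt ∈ Binf m)
    (hmin : ∀ z ∈ Binf m, dualObj D y zopt ≤ dualObj D y z) {s : Fin m → ℝ} (hs : s ∈ Binf m) :
    (y - D.mulVec zopt) ⬝ᵥ D.mulVec s ≤ (y - D.mulVec zopt) ⬝ᵥ D.mulVec zopt := by
  set u := D.mulVec zopt - y with hu
  set v := D.mulVec (s - zopt) with hv
  have key : 0 ≤ u ⬝ᵥ v := by
    refine nonneg_of_forall_quadratic_nonneg (c := v ⬝ᵥ v)
      (Finset.sum_nonneg fun i _ => mul_self_nonneg _) fun t ht0 ht1 => ?_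
    have h := hmin _ ((Binf_convex m).add_smul_sub_mem hz hs ⟨ht0, ht1⟩)
    have e : D.mulVec (zopt + t • (s - zopt)) - y = u + t • v := by
      rw [Matrix.mulVec_add, Matrix.mulVec_smul, hu, hv]
      abel
    rw [dualObj_eq_dotProduct, dualObj_eq_dotProduct, e, ← hu] at h
    simp only [add_dotProduct, dotProduct_add, smul_dotProduct, dotProduct_smul, smul_eq_mul,
      dotProduct_comm v u] at h
    nlinarith
  rw [← neg_sub, ← hu, neg_dotProduct, neg_dotProduct, neg_le_neg_iff]
  rwa [hv, Matrix.mulVec_sub, dotProduct_sub, sub_nonneg] at key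

theorem sign_mem_Binf {m : ℕ} (x : Fin m → ℝ) : (fun j => Real.sign (x j)) ∈ Binf m := by
  intro j
  rcases Real.sign_apply_eq (x j) with h | h | h <;> simp [h]

theorem dotProduct_sign {m : ℕ} (x : Fin m → ℝ) :
    x ⬝ᵥ (fun j => Real.sign (x j)) = ∑ j, |x j| := by
  refine Finset.sum_congr rfl fun j _ => ?_
  rcases lt_trichotomy (x j) 0 with h | h | h
  · simp [Real.sign_of_neg h, abs_of_neg h]
  · simp [h]
  · simp [Real.sign_of_pos h, abs_of_pos h]

theorem dotProduct_le_sum_abs {m : ℕ} (x : Fin m → ℝ) {z : Fin m → ℝ} (hz : z ∈ Binf m) :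
    x ⬝ᵥ z ≤ ∑ j, |x j| := by
  refine Finset.sum_le_sum fun j _ => (le_abs_self _).trans ?_
  rw [abs_mul]
  exact mul_le_of_le_one_right (abs_nonneg _) (hz j)

theorem dotProduct_mulVec_eq_transpose {p m : ℕ} (D : Matrix (Fin p) (Fin m) ℝ)
    (w : Fin p → ℝ) (z : Fin m → ℝ) :
    w ⬝ᵥ D.mulVec z = D.transpose.mulVec w ⬝ᵥ z := by
  rw [Matrix.dotProduct_mulVec, Matrix.mulVec_transpose]

/-- Quadratic growth of the primal objective around the point given by a dual minimizer. -/
theorem primalObj_add_le_of_dual_minimizer {p m : ℕ} {D : Matrix (Fin p) (Fin m) ℝ}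
    {y : Fin p → ℝ} {zopt : Fin m → ℝ} (hz : zopt ∈ Binf m)
    (hmin : ∀ z ∈ Binf m, dualObj D y zopt ≤ dualObj D y z) (w : Fin p → ℝ) :
    primalObj D y (y - D.mulVec zopt) +
      (1 / 2) * ((w - (y - D.mulVec zopt)) ⬝ᵥ (w - (y - D.mulVec zopt))) ≤ primalObj D y w := by
  have h1 := dotProduct_mulVec_le_of_dual_minimizer hz hmin
    (sign_mem_Binf (D.transpose.mulVec (y - D.mulVec zopt)))
  rw [dotProduct_mulVec_eq_transpose, dotProduct_sign] at h1
  have h2 := dotProduct_le_sum_abs (D.transpose.mulVec w) hz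
  rw [← dotProduct_mulVec_eq_transpose] at h2
  rw [primalObj_eq_dotProduct, primalObj_eq_dotProduct]
  generalize D.mulVec zopt = a at *
  simp only [sub_dotProduct, dotProduct_sub, dotProduct_comm a y, dotProduct_comm w y,
    dotProduct_comm a w] at *
  linarith

/-- If `ẑ ∈ B∞` minimizes the dual objective `G(z) = ½‖Dz − y‖₂²` over `B∞`, then
`ŵ = y − Dẑ` is the unique global minimizer over `ℝ^p` of the primal objective
`F(w) = ½‖y − w‖₂² + ‖Dᵀw‖₁`. -/
theorem dual_to_primal_minimizer (p m : ℕ)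
    (D : Matrix (Fin p) (Fin m) ℝ) (y : Fin p → ℝ)
    (zopt : Fin m → ℝ) (hz : zopt ∈ Binf m)
    (hmin : ∀ z ∈ Binf m, dualObj D y zopt ≤ dualObj D y z) :
    (∀ w : Fin p → ℝ, primalObj D y (y - D.mulVec zopt) ≤ primalObj D y w) ∧
    (∀ w' : Fin p → ℝ, (∀ w, primalObj D y w' ≤ primalObj D y w) →
      w' = y - D.mulVec zopt) := by
  have key := primalObj_add_le_of_dual_minimizer hz hmin
  refine ⟨fun w => ?_, fun w' hw' => ?_⟩
  · have h : 0 ≤ (w - (y - D.mulVec zopt)) ⬝ᵥ (w - (y - D.mulVec zopt)) :=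
      Finset.sum_nonneg fun i _ => mul_self_nonneg _
    linarith [key w]
  · have h : 0 ≤ (w' - (y - D.mulVec zopt)) ⬝ᵥ (w' - (y - D.mulVec zopt)) :=
      Finset.sum_nonneg fun i _ => mul_self_nonneg _
    exact sub_eq_zero.1 (dotProduct_self_eq_zero.1
      (by linarith [key w', hw' (y - D.mulVec zopt)]))
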